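/- Let Γ be a shellable (equivalently, pure) shifted simplicial complex on [n]. Then I_Γ admits a deformation M that is a generic Cohen-Macaulay monomial ideal; explicitly M = M_1 + ⋯ + M_{n−d} where M_j = ⟨∏_{i∈σ} x_i^{n−d−j+1} : σ ∈ Σ_j⟩. -/

import Mathlib

open Finset

open scoped Classical

set_option synthInstance.maxHeartbeats 1000000

/-- The monomial `x^a` in `k[x_1,…,x_n]` with exponent vector `a : Fin n → ℕ`. -/
noncomputable def mono (k : Type*) [CommSemiring k] {n : ℕ} (a : Fin n → ℕ) :
    MvPolynomial (Fin n) k :=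
  MvPolynomial.monomial (Finsupp.equivFunOnFinite.symm a) 1

/-- The monomial ideal generated by the monomials with exponent vectors in `G`. -/
noncomputable def monIdeal (k : Type*) [CommSemiring k] {n : ℕ}
    (G : Finset (Fin n → ℕ)) : Ideal (MvPolynomial (Fin n) k) :=
  Ideal.span ((fun a => mono k a) '' (G : Set (Fin n → ℕ)))

/-- Exponent vector of the lcm of the monomials with exponents in `σ`. -/
def lcmExp {n : ℕ} (σ : Finset (Fin n → ℕ)) : Fin n → ℕ :=
  fun i => σ.sup (fun a => a i)

/-- `c` strictly divides `b`: whenever `c` has positive degree in a variable,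
its degree there is strictly smaller than that of `b`. -/
def StrictlyDivides {n : ℕ} (c b : Fin n → ℕ) : Prop :=
  ∀ i, 0 < c i → c i < b i

/-- `G` is the set of exponent vectors of the minimal generators of a *generic*
monomial ideal: no generator divides another, and for any two distinct
generators with the same positive degree in some variable there is a third
generator strictly dividing their lcm. -/
def IsGeneric {n : ℕ} (G : Finset (Fin n → ℕ)) : Prop :=
  (∀ a ∈ G, ∀ b ∈ G, a ≤ b → a = b) ∧
  ∀ a ∈ G, ∀ b ∈ G, a ≠ b → (∃ h, a h = b h ∧ 0 < a h) →
    ∃ c ∈ G, c ≠ a ∧ c ≠ b ∧ StrictlyDivides c (fun i => max (a i) (b i))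

/-- `σ ⊆ G` is a face of the Scarf complex of the monomial ideal with minimal
generating exponents `G`: its lcm is attained by no other subset of `G`. -/
def ScarfFace {n : ℕ} (G σ : Finset (Fin n → ℕ)) : Prop :=
  σ ⊆ G ∧ ∀ τ ⊆ G, τ ≠ σ → lcmExp τ ≠ lcmExp σ

/-- The dimension (as an integer, so the empty-complex value `-1` is allowed)
of the Scarf complex `Δ_M`: one less than the largest cardinality of a face. -/
noncomputable def scarfDim {n : ℕ} (G : Finset (Fin n → ℕ)) : ℤ :=
  (((G.powerset.filter (fun σ => ScarfFace G σ)).sup Finset.card : ℕ) : ℤ) - 1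

/-- `σ` is a face of `V(M)`, the simplicial complex whose Stanley-Reisner ideal
is `rad M`: no generator of `M` has support contained in `σ`. -/
def VFace {n : ℕ} (G : Finset (Fin n → ℕ)) (σ : Finset (Fin n)) : Prop :=
  ∀ a ∈ G, ¬ (Finset.univ.filter (fun i => 0 < a i) ⊆ σ)

/-- The dimension of `V(M)` as an integer. -/
noncomputable def vDim {n : ℕ} (G : Finset (Fin n → ℕ)) : ℤ :=
  ((((Finset.univ : Finset (Fin n)).powerset.filter (fun σ => VFace G σ)).sup
    Finset.card : ℕ) : ℤ) - 1

/-- The quotient `S/I` of the polynomial ring `S = k[x_1,…,x_n]` is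
Cohen-Macaulay: some regular sequence on `S/I` consisting of elements of the
irrelevant maximal ideal `⟨x_1,…,x_n⟩` has length equal to the Krull dimension
of `S/I`. -/
def IsCMQuotient (k : Type*) [Field k] {n : ℕ}
    (I : Ideal (MvPolynomial (Fin n) k)) : Prop :=
  ∃ rs : List (MvPolynomial (Fin n) k),
    (∀ r ∈ rs, r ∈ Ideal.span (Set.range (MvPolynomial.X : Fin n → MvPolynomial (Fin n) k))) ∧
    RingTheory.Sequence.IsRegular (MvPolynomial (Fin n) k ⧸ I)
      (rs.map (Ideal.Quotient.mk I)) ∧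
    (rs.length : WithBot (WithTop ℕ)) = ringKrullDim (MvPolynomial (Fin n) k ⧸ I)

/-- A simplicial complex on the vertex set `V ⊆ Fin n`, given as its finite set of faces. -/
def IsComplexOn {n : ℕ} (V : Finset (Fin n)) (Γ : Finset (Finset (Fin n))) : Prop :=
  (∀ i ∈ V, ({i} : Finset (Fin n)) ∈ Γ) ∧ (∀ σ ∈ Γ, σ ⊆ V) ∧
    (∀ σ ∈ Γ, ∀ τ ⊆ σ, τ ∈ Γ)

/-- `σ` is a minimal non-face of `Γ`. -/
def IsMinNonFace {n : ℕ} (Γ : Finset (Finset (Fin n))) (σ : Finset (Fin n)) : Prop :=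
  σ ∉ Γ ∧ ∀ i ∈ σ, σ.erase i ∈ Γ

/-- `σ` is a facet (maximal face) of `Γ`. -/
def IsFacet {n : ℕ} (Γ : Finset (Finset (Fin n))) (σ : Finset (Fin n)) : Prop :=
  σ ∈ Γ ∧ ∀ τ ∈ Γ, σ ⊆ τ → τ = σ

/-- `Γ` has (simplicial) dimension `d - 1`. -/
def HasDim {n : ℕ} (Γ : Finset (Finset (Fin n))) (d : ℕ) : Prop :=
  (∀ σ ∈ Γ, σ.card ≤ d) ∧ (∃ σ ∈ Γ, σ.card = d)

/-- The finite set of minimal non-faces of `Γ`. -/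
noncomputable def minNonFaces {n : ℕ} (Γ : Finset (Finset (Fin n))) :
    Finset (Finset (Fin n)) :=
  (Finset.univ : Finset (Finset (Fin n))).filter (fun σ => IsMinNonFace Γ σ)

/-- `Γ` is pure of dimension `d - 1`: every facet has exactly `d` vertices. -/
def IsPureDim {n : ℕ} (Γ : Finset (Finset (Fin n))) (d : ℕ) : Prop :=
  HasDim Γ d ∧ ∀ σ, IsFacet Γ σ → σ.card = d

/-- `Γ` is shifted (vertices `0 < 1 < ⋯ < n-1`): replacing a vertex of a face
by any smaller vertex again yields a face. -/
def IsShifted {n : ℕ} (Γ : Finset (Finset (Fin n))) : Prop :=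
  ∀ σ ∈ Γ, ∀ j ∈ σ, ∀ i : Fin n, i < j → insert i (σ.erase j) ∈ Γ

/-- Membership in `Σ_j`: `σ` is a minimal non-face whose minimum vertex `v`
satisfies `v + |σ| = d + j` (0-indexed form of `σ = A ∪ {d-|A|+j}` with
`A ⊆ {d-|A|+j+1,…,n}`). -/
def MemSigma {n : ℕ} (Γ : Finset (Finset (Fin n))) (d j : ℕ)
    (σ : Finset (Fin n)) : Prop :=
  IsMinNonFace Γ σ ∧ ∃ v ∈ σ, (∀ w ∈ σ, v ≤ w) ∧ (v : ℕ) + σ.card = d + j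

/-- The smallest vertex label occurring in `σ` (as a natural number). -/
noncomputable def minVal {n : ℕ} (σ : Finset (Fin n)) : ℕ :=
  sInf {m : ℕ | ∃ v ∈ σ, (v : ℕ) = m}

/-- The exponent vector of the generator of `M_j` associated with `σ ∈ Σ_j`:
each variable of `σ` gets exponent `n - d - j + 1` (which for `σ ∈ Σ_j` equals
`n + 1 - |σ| - min σ`), the others exponent `0`. -/
noncomputable def shiftExp (n : ℕ) (σ : Finset (Fin n)) : Fin n → ℕ :=
  fun i => if i ∈ σ then n + 1 - σ.card - minVal σ else 0

open MvPolynomial in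
/-- The ideal spanned by the monomials whose exponent vectors lie outside `L`. -/
noncomputable def complIdeal (k : Type*) [Field k] {n : ℕ} (L : Set (Fin n →₀ ℕ)) :
    Ideal (MvPolynomial (Fin n) k) :=
  Ideal.span ((fun a => monomial a (1 : k)) '' Lᶜ)

section Algebra

open MvPolynomial

variable {k : Type*} [Field k] {n : ℕ}

theorem mem_complIdeal {L : Set (Fin n →₀ ℕ)} (hL : IsLowerSet L)
    {p : MvPolynomial (Fin n) k} :
    p ∈ complIdeal k L ↔ ∀ a ∈ p.support, a ∉ L := by
  rw [complIdeal, mem_ideal_span_monomial_image]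
  refine forall₂_congr fun a _ => ⟨?_, fun h => ⟨a, h, le_rfl⟩⟩
  rintro ⟨b, hb, hba⟩ ha
  exact hb (hL hba ha)

theorem monomial_mem_complIdeal {L : Set (Fin n →₀ ℕ)} {a : Fin n →₀ ℕ} (ha : a ∉ L) (c : k) :
    monomial a c ∈ complIdeal k L := by
  have : monomial a c = C c * monomial a 1 := by simp [C_mul_monomial]
  rw [this]
  exact Ideal.mul_mem_left _ _ (Ideal.subset_span ⟨a, ha, rfl⟩)

theorem monomial_mul_mem_complIdeal {L : Set (Fin n →₀ ℕ)} (hL : IsLowerSet L) (b : Fin n →₀ ℕ)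
    {p : MvPolynomial (Fin n) k} :
    monomial b 1 * p ∈ complIdeal k L ↔ p ∈ complIdeal k {a | a + b ∈ L} := by
  have hL' : IsLowerSet {a | a + b ∈ L} := fun x y hxy hx =>
    hL (add_le_add_left hxy b) hx
  rw [mem_complIdeal hL, mem_complIdeal hL']
  constructor
  · intro h a ha
    refine h (a + b) ?_
    rw [mem_support_iff, add_comm, coeff_monomial_mul, one_mul]
    exact mem_support_iff.1 ha
  · intro h a ha haL
    rw [mem_support_iff, coeff_monomial_mul'] at ha
    split_ifs at ha with hba
    · refine h (a - b) ?_ ?_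
      · rw [mem_support_iff]; simpa using ha
      · simpa [tsub_add_cancel_of_le hba] using haL
    · exact ha rfl

theorem complIdeal_sup_monomial (L : Set (Fin n →₀ ℕ)) (b : Fin n →₀ ℕ) :
    complIdeal k L ⊔ Ideal.span {monomial b (1 : k)} = complIdeal k {a | a ∈ L ∧ ¬ b ≤ a} := by
  apply le_antisymm
  · refine sup_le (Ideal.span_mono (Set.image_mono ?_)) ?_
    · intro a ha h
      exact ha h.1
    · rw [Ideal.span_singleton_le_iff_mem]
      exact monomial_mem_complIdeal (fun h => h.2 le_rfl) 1
  · rw [complIdeal, Ideal.span_le]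
    rintro _ ⟨a, ha, rfl⟩
    by_cases haL : a ∈ L
    · have hb : b ≤ a := by
        by_contra hb
        exact ha ⟨haL, hb⟩
      refine Ideal.mem_sup_right (Ideal.mem_span_singleton.2 ⟨monomial (a - b) 1, ?_⟩)
      simp [monomial_mul, add_tsub_cancel_of_le hb]
    · exact Ideal.mem_sup_left (monomial_mem_complIdeal haL 1)

/-- A down-closed set of exponent vectors built up by extensions, along multiplication by a
variable, from the exponent vectors of the monomials in `d` of the variables. -/
inductive Filt {n : ℕ} (d : ℕ) : Set (Fin n →₀ ℕ) → Prop
  | empty : Filt d ∅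
  | face (F : Finset (Fin n)) (hF : F.card = d) : Filt d {a | a.support ⊆ F}
  | step (L : Set (Fin n →₀ ℕ)) (i : Fin n) : IsLowerSet L →
      Filt d {a | a + Finsupp.single i 1 ∈ L} → Filt d {a | a ∈ L ∧ a i = 0} → Filt d L

theorem isLowerSet_support_subset (F : Finset (Fin n)) :
    IsLowerSet {a : Fin n →₀ ℕ | a.support ⊆ F} := fun _ _ hab ha =>
  (Finsupp.support_mono hab).trans ha

theorem Filt.isLowerSet {d : ℕ} {L : Set (Fin n →₀ ℕ)} (h : Filt d L) : IsLowerSet L := by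
  cases h with
  | empty => exact isLowerSet_empty
  | face F => exact isLowerSet_support_subset F
  | step _ _ h => exact h

theorem filt_support_subset_of_exists {d : ℕ} {F : Finset (Fin n)} (hF : F.card = d + 1)
    (G : Finset (Fin n)) (hG : G ⊆ F) :
    Filt d {a : Fin n →₀ ℕ | a.support ⊆ F ∧ ∃ j ∈ G, a j = 0} := by
  induction G using Finset.induction_on with
  | empty => simpa using Filt.empty
  | insert i G hi ih =>
    have hiF : i ∈ F := hG (mem_insert_self i G)
    refine Filt.step _ i ?_ ?_ ?_
    · rintro a b hab ⟨ha, j, hj, haj⟩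
      exact ⟨isLowerSet_support_subset F hab ha, j, hj, Nat.le_zero.1 (haj ▸ hab j)⟩
    · convert ih ((subset_insert i G).trans hG) using 1
      ext a
      constructor
      · rintro ⟨h, j, hj, haj⟩
        have hji : j ≠ i := by
          rintro rfl
          simp at haj
        refine ⟨isLowerSet_support_subset F (show a ≤ a + _ from le_self_add) h, j,
          (mem_insert.1 hj).resolve_left hji, by simp at haj; exact haj.1⟩
      · rintro ⟨h, j, hj, haj⟩
        have hji : i ≠ j := by
          rintro rfl
          exact hi hj
        refine ⟨Finsupp.support_add.trans (union_subset h ?_), j, mem_insert_of_mem hj, by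
          simp [haj, Finsupp.single_eq_of_ne' hji]⟩
        exact Finsupp.support_single_subset.trans (singleton_subset_iff.2 hiF)
    · have hcard : (F.erase i).card = d := by rw [card_erase_of_mem hiF, hF]; rfl
      convert Filt.face (F.erase i) hcard using 1
      ext a
      simp only [Set.mem_ofPred_eq, subset_erase, Finsupp.mem_support_iff, not_not]
      exact ⟨fun h => ⟨h.1.1, h.2⟩, fun h => ⟨⟨h.1, i, mem_insert_self i G, h.2⟩, h.2⟩⟩

/-- `rs` is a weakly regular sequence on the quotient by `J`. -/
def RegSeq {R : Type*} [CommRing R] : List R → Ideal R → Prop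
  | [], _ => True
  | r :: rs, J => (∀ p, r * p ∈ J → p ∈ J) ∧ RegSeq rs (J ⊔ Ideal.span {r})

theorem RegSeq.of_colon {R : Type*} [CommRing R] (f : R) (rs : List R) (J K : Ideal R)
    (hK : ∀ p, p ∈ K ↔ f * p ∈ J) (h₁ : RegSeq rs K) (h₂ : RegSeq rs (J ⊔ Ideal.span {f})) :
    RegSeq rs J := by
  induction rs generalizing J K with
  | nil => trivial
  | cons r rs ih =>
    obtain ⟨hr₁, h₁⟩ := h₁
    obtain ⟨hr₂, h₂⟩ := h₂
    refine ⟨fun p hp => ?_, ih _ _ (fun p => ?_) h₁ (by rwa [sup_right_comm])⟩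
    · obtain ⟨s, j, hj, rfl⟩ := Ideal.mem_span_singleton_sup.1
        (sup_comm J _ ▸ hr₂ p (Ideal.mem_sup_left hp))
      have : r * (s * f) ∈ J := by
        have := J.sub_mem hp (J.mul_mem_left r hj)
        rwa [mul_add, add_sub_cancel_right] at this
      have hs : s ∈ K := hr₁ _ ((hK _).2 (by convert this using 1; ring))
      exact J.add_mem (mul_comm f s ▸ (hK s).1 hs) hj
    · rw [sup_comm J, sup_comm K, Ideal.mem_span_singleton_sup, Ideal.mem_span_singleton_sup]
      constructor
      · rintro ⟨a, b, hb, rfl⟩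
        exact ⟨f * a, f * b, (hK b).1 hb, by ring⟩
      · rintro ⟨a, b, hb, hab⟩
        have ha : r * a ∈ J ⊔ Ideal.span {f} := by
          have : r * a = f * p + -b := by rw [← hab]; ring
          rw [this]
          exact add_mem (Ideal.mem_sup_right (Ideal.mul_mem_right _ _
            (Ideal.mem_span_singleton_self f))) (Ideal.mem_sup_left (neg_mem hb))
        obtain ⟨s, j, hj, rfl⟩ := Ideal.mem_span_singleton_sup.1 (sup_comm J _ ▸ hr₂ a ha)
        refine ⟨s, p - s * r, (hK _).2 ?_, by ring⟩
        have : f * (p - s * r) = r * j + b := by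
          rw [mul_sub, ← hab]; ring
        rw [this]
        exact J.add_mem (J.mul_mem_left _ hj) hb

theorem RegSeq.top {R : Type*} [CommRing R] (rs : List R) : RegSeq rs (⊤ : Ideal R) := by
  induction rs with
  | nil => trivial
  | cons r rs ih => exact ⟨fun _ _ => trivial, by rwa [top_sup_eq]⟩

open scoped Pointwise in
theorem RegSeq.isWeaklyRegular {R : Type*} [CommRing R] {rs : List R} {J : Ideal R}
    (h : RegSeq rs J) : RingTheory.Sequence.IsWeaklyRegular (R ⧸ J) rs := by
  induction rs generalizing J with
  | nil => exact RingTheory.Sequence.IsWeaklyRegular.nil _ _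
  | cons r rs ih =>
    refine RingTheory.Sequence.IsWeaklyRegular.cons ?_ ?_
    · rw [isSMulRegular_iff_right_eq_zero_of_smul]
      intro x hx
      obtain ⟨p, rfl⟩ := Ideal.Quotient.mk_surjective x
      rw [← Ideal.Quotient.mk_eq_mk, ← Submodule.Quotient.mk_smul, Submodule.Quotient.mk_eq_zero,
        smul_eq_mul] at hx
      exact Ideal.Quotient.eq_zero_iff_mem.2 (h.1 p hx)
    · have hker : LinearMap.ker ((Submodule.mkQ (r • (⊤ : Submodule R (R ⧸ J)))).comp
          (Submodule.mkQ J)) = J ⊔ Ideal.span {r} := by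
        ext p
        simp only [LinearMap.mem_ker, LinearMap.comp_apply, Submodule.mkQ_apply,
          Submodule.Quotient.mk_eq_zero, Submodule.mem_smul_pointwise_iff_exists]
        rw [sup_comm, Ideal.mem_span_singleton_sup]
        constructor
        · rintro ⟨x, -, hx⟩
          obtain ⟨q, rfl⟩ := Submodule.Quotient.mk_surjective _ x
          rw [← Submodule.Quotient.mk_smul, eq_comm, Submodule.Quotient.eq] at hx
          exact ⟨q, _, hx, by simp [mul_comm]⟩
        · rintro ⟨a, b, hb, rfl⟩
          refine ⟨Submodule.Quotient.mk a, trivial, ?_⟩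
          rw [← Submodule.Quotient.mk_smul, eq_comm, Submodule.Quotient.eq]
          simpa [mul_comm] using hb
      have e := (Submodule.quotEquivOfEq _ _ hker.symm).trans
        (LinearMap.quotKerEquivOfSurjective _
          ((Submodule.mkQ_surjective (r • (⊤ : Submodule R (R ⧸ J)))).comp
            (Submodule.mkQ_surjective J)))
      exact (e.isWeaklyRegular_congr rs).1 (ih h.2)

/-- The elementary symmetric polynomials of degrees `d, d - 1, …, 1`. -/
noncomputable def esymms (k : Type*) [Field k] (n : ℕ) : ℕ → List (MvPolynomial (Fin n) k)
  | 0 => []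
  | d + 1 => esymm (Fin n) k (d + 1) :: esymms k n d

theorem length_esymms (d : ℕ) : (esymms k n d).length = d := by
  induction d with
  | zero => rfl
  | succ d ih => simp [esymms, ih]

theorem esymm_succ_mem (d : ℕ) :
    esymm (Fin n) k (d + 1) ∈ Ideal.span (Set.range (X : Fin n → MvPolynomial (Fin n) k)) := by
  refine sum_mem fun t ht => ?_
  obtain ⟨i, hi⟩ : t.Nonempty := card_pos.1 (by rw [(mem_powersetCard.1 ht).2]; omega)
  rw [← mul_prod_erase t _ hi]
  exact Ideal.mul_mem_right _ _ (Ideal.subset_span ⟨i, rfl⟩)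

theorem mem_span_X_of_mem_esymms {d : ℕ} {r : MvPolynomial (Fin n) k} (hr : r ∈ esymms k n d) :
    r ∈ Ideal.span (Set.range (X : Fin n → MvPolynomial (Fin n) k)) := by
  induction d with
  | zero => simp [esymms] at hr
  | succ d ih =>
    rcases List.mem_cons.1 hr with rfl | hr
    · exact esymm_succ_mem d
    · exact ih hr

/-- The exponent vector of the product of the variables indexed by `F`. -/
noncomputable def sqfree (F : Finset (Fin n)) : Fin n →₀ ℕ := ∑ i ∈ F, Finsupp.single i 1

theorem sqfree_apply (F : Finset (Fin n)) (i : Fin n) : sqfree F i = if i ∈ F then 1 else 0 := by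
  simp [sqfree, Finsupp.finsetSum_apply, Finsupp.single_apply]

theorem support_sqfree (F : Finset (Fin n)) : (sqfree F).support = F := by
  ext i
  simp [sqfree_apply]

theorem esymm_sub_mem {F : Finset (Fin n)} {d : ℕ} (hF : F.card = d) :
    esymm (Fin n) k d - monomial (sqfree F) 1 ∈ complIdeal k {a | a.support ⊆ F} := by
  rw [esymm_eq_sum_monomial]
  have hmem : F ∈ powersetCard d univ := mem_powersetCard.2 ⟨subset_univ _, hF⟩
  rw [← add_sum_erase _ _ hmem]
  change monomial (sqfree F) 1 + _ - _ ∈ _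
  rw [add_sub_cancel_left]
  refine sum_mem fun t ht => monomial_mem_complIdeal ?_ 1
  obtain ⟨htF, ht⟩ := mem_erase.1 ht
  intro h
  change (sqfree t).support ⊆ F at h
  rw [support_sqfree] at h
  exact htF (eq_of_subset_of_card_le h (by rw [hF, (mem_powersetCard.1 ht).2]))

theorem Filt.regSeq {d : ℕ} {L : Set (Fin n →₀ ℕ)} (h : Filt d L) :
    RegSeq (esymms k n d) (complIdeal k L) := by
  induction d generalizing L with
  | zero => trivial
  | succ d ih =>
    induction h with
    | empty =>
      convert RegSeq.top _
      rw [Ideal.eq_top_iff_one]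
      exact monomial_mem_complIdeal (a := 0) (Set.notMem_empty _) 1
    | face F hF =>
      have hlow := isLowerSet_support_subset F
      have hsub := esymm_sub_mem (k := k) hF
      refine ⟨fun p hp => ?_, ?_⟩
      · have : monomial (sqfree F) 1 * p ∈ complIdeal k {a | a.support ⊆ F} := by
          have := sub_mem hp (Ideal.mul_mem_right p _ hsub)
          rwa [← sub_mul, sub_sub_cancel] at this
        rw [monomial_mul_mem_complIdeal hlow] at this
        convert this using 2
        ext a
        constructor
        · intro ha
          exact Finsupp.support_add.trans (union_subset ha (support_sqfree F).subset)
        · exact fun ha => hlow (show a ≤ a + _ from le_self_add) ha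
      · convert ih (filt_support_subset_of_exists hF F Subset.rfl)
        have : complIdeal k {a | a.support ⊆ F} ⊔ Ideal.span {esymm (Fin n) k (d + 1)} =
            complIdeal k {a | a.support ⊆ F} ⊔ Ideal.span {monomial (sqfree F) 1} := by
          apply le_antisymm
          · refine sup_le le_sup_left ((Ideal.span_singleton_le_iff_mem _).2 ?_)
            have := add_mem (Ideal.mem_sup_left (T := Ideal.span {monomial (sqfree F) (1 : k)}) hsub)
              (Ideal.mem_sup_right (Ideal.mem_span_singleton_self _))
            rwa [sub_add_cancel] at this
          · refine sup_le le_sup_left ((Ideal.span_singleton_le_iff_mem _).2 ?_)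
            have := sub_mem (Ideal.mem_sup_right (Ideal.mem_span_singleton_self _))
              (Ideal.mem_sup_left (T := Ideal.span {esymm (Fin n) k (d + 1)}) hsub)
            rwa [sub_sub_cancel] at this
        rw [this, complIdeal_sup_monomial]
        congr 1
        ext a
        simp only [Set.mem_ofPred_eq, Finsupp.le_def, sqfree_apply, not_forall]
        refine and_congr_right fun _ => exists_congr fun i => ?_
        split_ifs with hi <;> simp [hi]
    | step L i hL h₁ h₂ ih₁ ih₂ =>
      refine RegSeq.of_colon (monomial (Finsupp.single i 1) 1) _ _ _
        (fun p => (monomial_mul_mem_complIdeal hL _).symm) ih₁ ?_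
      rw [complIdeal_sup_monomial]
      convert ih₂ using 4
      simp [Nat.one_le_iff_ne_zero]

theorem Filt.exists_face_le {d : ℕ} {L : Set (Fin n →₀ ℕ)} (h : Filt d L)
    {P : Ideal (MvPolynomial (Fin n) k)} [hP : P.IsPrime] (hLP : complIdeal k L ≤ P) :
    ∃ F : Finset (Fin n), F.card = d ∧ complIdeal k {a | a.support ⊆ F} ≤ P := by
  induction h with
  | empty =>
    refine absurd (P.eq_top_iff_one.2 (hLP ?_)) hP.ne_top
    exact monomial_mem_complIdeal (a := 0) (Set.notMem_empty _) 1
  | face F hF => exact ⟨F, hF, hLP⟩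
  | step L i hL h₁ h₂ ih₁ ih₂ =>
    by_cases hi : monomial (Finsupp.single i 1) 1 ∈ P
    · refine ih₂ ?_
      have := complIdeal_sup_monomial (k := k) L (Finsupp.single i 1)
      convert sup_le hLP ((Ideal.span_singleton_le_iff_mem _).2 hi)
      rw [this]
      congr
      simp [Nat.one_le_iff_ne_zero]
    · refine ih₁ fun p hp => (hP.mem_or_mem (hLP ?_)).resolve_left hi
      exact (monomial_mul_mem_complIdeal hL _).2 hp

theorem ringKrullDim_quotient_complIdeal_face (F : Finset (Fin n)) :
    ringKrullDim (MvPolynomial (Fin n) k ⧸ complIdeal k {a | a.support ⊆ F}) = F.card := by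
  let φ : MvPolynomial (Fin n) k →ₐ[k] MvPolynomial F k := killCompl Subtype.val_injective
  have hφ : Function.Surjective φ := fun p => ⟨_, killCompl_rename_app Subtype.val_injective p⟩
  have hker : RingHom.ker φ.toRingHom = complIdeal k {a | a.support ⊆ F} := by
    ext p
    rw [mem_complIdeal (isLowerSet_support_subset F), RingHom.mem_ker]
    change φ p = 0 ↔ _
    rw [MvPolynomial.ext_iff]
    constructor
    · intro h a ha haF
      have := h (a.comapDomain Subtype.val Subtype.val_injective.injOn)
      rw [coeff_killCompl, Finsupp.mapDomain_comapDomain _ Subtype.val_injective _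
        (by simpa using haF)] at this
      exact mem_support_iff.1 ha this
    · intro h a
      rw [coeff_killCompl, coeff_zero]
      by_contra hne
      refine h _ (mem_support_iff.2 hne) ?_
      refine (Finsupp.mapDomain_support).trans ?_
      intro i hi
      obtain ⟨j, -, rfl⟩ := mem_image.1 hi
      exact j.2
  rw [← hker, ringKrullDim_eq_of_ringEquiv
    (RingHom.quotientKerEquivOfSurjective (f := φ.toRingHom) hφ),
    MvPolynomial.ringKrullDim_of_isNoetherianRing, ringKrullDim_eq_zero_of_field]
  simp

theorem Filt.ringKrullDim_quotient_le {d : ℕ} {L : Set (Fin n →₀ ℕ)} (h : Filt d L) :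
    ringKrullDim (MvPolynomial (Fin n) k ⧸ complIdeal k L) ≤ d := by
  rw [ringKrullDim_quotient]
  refine iSup_le fun c => ?_
  obtain ⟨F, hF, hle⟩ := h.exists_face_le (k := k) (hP := c.head.1.2) c.head.2
  rw [← hF, ← ringKrullDim_quotient_complIdeal_face (k := k) F, ringKrullDim_quotient]
  let c' : LTSeries (PrimeSpectrum.zeroLocus
      (complIdeal k {a | a.support ⊆ F} : Set (MvPolynomial (Fin n) k))) :=
    { length := c.length
      toFun := fun i => ⟨(c i).1, hle.trans (show c.head.1.asIdeal ≤ (c i).1.asIdeal from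
        c.head_le i)⟩
      step := fun i => c.step i }
  exact le_iSup (fun p : LTSeries _ => (p.length : WithBot ℕ∞)) c'

theorem Filt.isCMQuotient {d : ℕ} {L : Set (Fin n →₀ ℕ)} (h : Filt d L) {F : Finset (Fin n)}
    (hF : F.card = d) (hFL : ∀ a : Fin n →₀ ℕ, a.support ⊆ F → a ∈ L) :
    IsCMQuotient k (complIdeal k L) := by
  have h0 : (0 : Fin n →₀ ℕ) ∈ L := hFL 0 (by simp)
  refine ⟨esymms k n d, fun r hr => mem_span_X_of_mem_esymms hr, ⟨?_, ?_⟩, ?_⟩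
  · exact (RingTheory.Sequence.isWeaklyRegular_map_algebraMap_iff _ _ _).2
      (h.regSeq (k := k)).isWeaklyRegular
  · intro htop
    have h1 : (1 : MvPolynomial (Fin n) k ⧸ complIdeal k L) ∈
        Ideal.ofList ((esymms k n d).map (Ideal.Quotient.mk (complIdeal k L))) := by
      have : (1 : MvPolynomial (Fin n) k ⧸ complIdeal k L) ∈ (⊤ : Ideal _) := trivial
      rw [htop] at this
      simpa using this
    let ε : MvPolynomial (Fin n) k ⧸ complIdeal k L →+* k :=
      Ideal.Quotient.lift _ (constantCoeff) (by
        intro p hp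
        rw [mem_complIdeal h.isLowerSet] at hp
        rw [constantCoeff_eq]
        by_contra hne
        exact hp 0 (mem_support_iff.2 hne) h0)
    have hle : Ideal.ofList ((esymms k n d).map (Ideal.Quotient.mk (complIdeal k L))) ≤
        RingHom.ker ε := by
      refine Ideal.span_le.2 fun r hr => ?_
      obtain ⟨p, hp, rfl⟩ := List.mem_map.1 hr
      have hX : Ideal.span (Set.range (X : Fin n → MvPolynomial (Fin n) k)) ≤
          RingHom.ker (constantCoeff : MvPolynomial (Fin n) k →+* k) := by
        refine Ideal.span_le.2 ?_
        rintro _ ⟨i, rfl⟩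
        simp [RingHom.mem_ker]
      exact hX (mem_span_X_of_mem_esymms hp)
    have := hle h1
    rw [RingHom.mem_ker, map_one] at this
    exact one_ne_zero this
  · rw [length_esymms]
    refine le_antisymm ?_ h.ringKrullDim_quotient_le
    have hle : complIdeal k L ≤ complIdeal k {a | a.support ⊆ F} :=
      Ideal.span_mono (Set.image_mono (Set.compl_subset_compl.2 hFL))
    have := ringKrullDim_le_of_surjective _ (Ideal.Quotient.factor_surjective hle)
    rwa [ringKrullDim_quotient_complIdeal_face, hF] at this

end Algebra

section LevelSets

variable {n : ℕ}

theorem filt_of_slices {d : ℕ} (i : Fin n) (T : ℕ) {L : Set (Fin n →₀ ℕ)} (hL : IsLowerSet L)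
    (h₀ : ∀ e < T, Filt d {b | b i = 0 ∧ b + Finsupp.single i e ∈ L})
    (h₁ : Filt d {b | b + Finsupp.single i T ∈ L}) : Filt d L := by
  induction T generalizing L with
  | zero => simpa using h₁
  | succ T ih =>
    have hadd : ∀ (b : Fin n →₀ ℕ) (e : ℕ),
        b + Finsupp.single i e + Finsupp.single i 1 = b + Finsupp.single i (e + 1) := by
      intro b e
      rw [add_assoc, ← Finsupp.single_add]
    refine Filt.step L i hL (ih ?_ ?_ ?_) ?_
    · exact fun x y hxy hx => hL (add_le_add_left hxy _) hx
    · intro e he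
      convert h₀ (e + 1) (by omega) using 4
      simp only [Set.mem_ofPred_eq, hadd]
    · convert h₁ using 3
      simp only [Set.mem_ofPred_eq, hadd]
    · convert h₀ 0 (by omega) using 3
      simp [and_comm]

/-- Every final segment of the subset `P` of `[0, m)` that has fewer than `r` gaps lies in `Λ`. -/
def GapCond (m r : ℕ) (Λ : Set (Finset (Fin n))) (P : Fin n → Prop) : Prop :=
  ∀ j ≤ m, #{i : Fin n | j ≤ (i : ℕ) ∧ (i : ℕ) < m ∧ ¬ P i} < r →
    ({i : Fin n | j ≤ (i : ℕ) ∧ (i : ℕ) < m ∧ P i} : Finset (Fin n)) ∈ Λ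

theorem GapCond.mono {m r : ℕ} {Λ Λ' : Set (Finset (Fin n))} {P Q : Fin n → Prop}
    (hΛ : Λ ⊆ Λ') (hΛ' : IsLowerSet Λ') (hPQ : ∀ i : Fin n, (i : ℕ) < m → Q i → P i)
    (h : GapCond m r Λ P) : GapCond m r Λ' Q := by
  intro j hj hlt
  refine hΛ' ?_ (hΛ (h j hj (lt_of_le_of_lt (card_le_card ?_) hlt)))
  · intro i
    simp only [mem_filter, mem_univ, true_and]
    exact fun ⟨h₁, h₂, h₃⟩ => ⟨h₁, h₂, hPQ i h₂ h₃⟩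
  · intro i
    simp only [mem_filter, mem_univ, true_and]
    exact fun ⟨h₁, h₂, h₃⟩ => ⟨h₁, h₂, fun h => h₃ (hPQ i h₂ h)⟩

theorem gapCond_congr {m r : ℕ} {Λ : Set (Finset (Fin n))} {P Q : Fin n → Prop}
    (hΛ : IsLowerSet Λ) (hPQ : ∀ i : Fin n, (i : ℕ) < m → (P i ↔ Q i)) :
    GapCond m r Λ P ↔ GapCond m r Λ Q :=
  ⟨GapCond.mono subset_rfl hΛ fun i hi => (hPQ i hi).2,
    GapCond.mono subset_rfl hΛ fun i hi => (hPQ i hi).1⟩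

/-- The link of the vertex `s` in `Λ`, where `s` need not be excluded from the faces. -/
def linkSet (s : Fin n) (Λ : Set (Finset (Fin n))) : Set (Finset (Fin n)) :=
  {F | insert s F ∈ Λ}

theorem isLowerSet_linkSet {s : Fin n} {Λ : Set (Finset (Fin n))} (hΛ : IsLowerSet Λ) :
    IsLowerSet (linkSet s Λ) := fun _ _ hxy hx => hΛ (insert_subset_insert s hxy) hx

theorem linkSet_subset {s : Fin n} {Λ : Set (Finset (Fin n))} (hΛ : IsLowerSet Λ) :
    linkSet s Λ ⊆ Λ := fun F hF => hΛ (subset_insert s F) hF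

theorem gapCond_succ_of_pos {s : Fin n} {r : ℕ} {Λ : Set (Finset (Fin n))} {P : Fin n → Prop}
    (hΛ : IsLowerSet Λ) (hs : P s) :
    GapCond (s + 1) r Λ P ↔ GapCond s r (linkSet s Λ) P := by
  have hgap : ∀ j : ℕ, ({i : Fin n | j ≤ (i : ℕ) ∧ (i : ℕ) < s + 1 ∧ ¬ P i} : Finset (Fin n)) =
      ({i : Fin n | j ≤ (i : ℕ) ∧ (i : ℕ) < s ∧ ¬ P i} : Finset (Fin n)) := by
    intro j
    ext i
    simp only [mem_filter, mem_univ, true_and]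
    refine and_congr_right fun _ => and_congr_left fun hi => ?_
    have : (i : ℕ) ≠ s := fun h => hi (Fin.ext h ▸ hs)
    omega
  have hface : ∀ j ≤ (s : ℕ),
      ({i : Fin n | j ≤ (i : ℕ) ∧ (i : ℕ) < s + 1 ∧ P i} : Finset (Fin n)) =
      insert s ({i : Fin n | j ≤ (i : ℕ) ∧ (i : ℕ) < s ∧ P i} : Finset (Fin n)) := by
    intro j hj
    ext i
    simp only [mem_filter, mem_univ, true_and, mem_insert]
    rcases eq_or_ne i s with rfl | his
    · simp [hs, hj]
    · have : (i : ℕ) ≠ s := fun h => his (Fin.ext h)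
      simp only [his, false_or]
      refine and_congr_right fun _ => and_congr_left fun hi => ?_
      omega
  constructor
  · intro h j hj hlt
    change insert s _ ∈ Λ
    rw [← hface j hj]
    exact h j (by omega) (by rwa [hgap])
  · intro h j hj hlt
    rw [hgap] at hlt
    rcases Nat.lt_or_ge s j with hsj | hjs
    · refine hΛ ?_ (h s le_rfl (lt_of_le_of_lt (card_le_card ?_) hlt))
      · intro i
        simp only [mem_filter, mem_univ, true_and]
        omega
      · intro i
        simp only [mem_filter, mem_univ, true_and]
        omega
    · rw [hface j hjs]
      exact h j hjs hlt

theorem gapCond_succ_of_neg {s : Fin n} {r : ℕ} {Λ : Set (Finset (Fin n))} {P : Fin n → Prop}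
    (h0 : ∅ ∈ Λ) (hs : ¬ P s) :
    GapCond (s + 1) (r + 1) Λ P ↔ GapCond s r Λ P := by
  have hface : ∀ j : ℕ, ({i : Fin n | j ≤ (i : ℕ) ∧ (i : ℕ) < s + 1 ∧ P i} : Finset (Fin n)) =
      ({i : Fin n | j ≤ (i : ℕ) ∧ (i : ℕ) < s ∧ P i} : Finset (Fin n)) := by
    intro j
    ext i
    simp only [mem_filter, mem_univ, true_and]
    refine and_congr_right fun _ => and_congr_left fun hi => ?_
    have : (i : ℕ) ≠ s := fun h => hs (Fin.ext h ▸ hi)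
    omega
  have hgap : ∀ j ≤ (s : ℕ),
      #{i : Fin n | j ≤ (i : ℕ) ∧ (i : ℕ) < s + 1 ∧ ¬ P i} =
      #{i : Fin n | j ≤ (i : ℕ) ∧ (i : ℕ) < s ∧ ¬ P i} + 1 := by
    intro j hj
    rw [← card_insert_of_notMem (a := s) (by simp)]
    congr 1
    ext i
    simp only [mem_filter, mem_univ, true_and, mem_insert]
    rcases eq_or_ne i s with rfl | his
    · simp [hs, hj]
    · have : (i : ℕ) ≠ s := fun h => his (Fin.ext h)
      simp only [his, false_or]
      refine and_congr_right fun _ => and_congr_left fun hi => ?_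
      omega
  constructor
  · intro h j hj hlt
    rw [← hface j]
    exact h j (by omega) (by rw [hgap j hj]; omega)
  · intro h j hj hlt
    rw [hface]
    rcases Nat.lt_or_ge s j with hsj | hjs
    · convert h0
      ext i
      simp only [mem_filter, mem_univ, true_and, notMem_empty, iff_false]
      omega
    · rw [hgap j hjs] at hlt
      exact h j hjs (by omega)

/-- Exponent vectors supported on `[0, m) ∪ K` such that for `1 ≤ r ≤ R` the set of indices below
`m` with exponent at least `t r` satisfies `GapCond m r (Λ r)`. -/
def levelSet (m : ℕ) (K : Finset (Fin n)) (R : ℕ) (t : ℕ → ℕ) (Λ : ℕ → Set (Finset (Fin n))) :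
    Set (Fin n →₀ ℕ) :=
  {a | (∀ i : Fin n, m ≤ (i : ℕ) → i ∉ K → a i = 0) ∧
    ∀ r, 1 ≤ r → r ≤ R → GapCond m r (Λ r) fun i => t r ≤ a i}

theorem isLowerSet_levelSet {m : ℕ} {K : Finset (Fin n)} {R : ℕ} {t : ℕ → ℕ}
    {Λ : ℕ → Set (Finset (Fin n))} (hΛ : ∀ r, IsLowerSet (Λ r)) :
    IsLowerSet (levelSet m K R t Λ) := fun _ _ hba ha =>
  ⟨fun i hi hiK => Nat.le_zero.1 (ha.1 i hi hiK ▸ hba i), fun r hr hrR =>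
    (ha.2 r hr hrR).mono subset_rfl (hΛ r) fun i _ h => le_trans h (hba i)⟩

theorem levelSet_eq_empty {m : ℕ} {K : Finset (Fin n)} {R : ℕ} {t : ℕ → ℕ}
    {Λ : ℕ → Set (Finset (Fin n))} (hR : 1 ≤ R) (h : ∅ ∉ Λ 1) :
    levelSet m K R t Λ = ∅ := by
  refine Set.eq_empty_of_forall_notMem fun a ha => h ?_
  have := ha.2 1 le_rfl hR m le_rfl
  convert this ?_ using 1
  · ext i
    simp only [mem_filter, mem_univ, true_and, notMem_empty, false_iff]
    omega
  · rw [Nat.lt_one_iff, card_eq_zero]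
    ext i
    simp only [mem_filter, mem_univ, true_and, notMem_empty, iff_false]
    omega

theorem shift_levelSet_top {s : Fin n} {K : Finset (Fin n)} {R : ℕ} {t : ℕ → ℕ}
    {Λ : ℕ → Set (Finset (Fin n))} (hΛ : ∀ r, IsLowerSet (Λ r)) (ht : StrictMono t)
    (hsK : s ∉ K) (hK : ∀ i ∈ K, (s : ℕ) + 1 ≤ i) :
    {b | b + Finsupp.single s (t R) ∈ levelSet (s + 1) K R t Λ} =
      levelSet s (insert s K) R t fun r => linkSet s (Λ r) := by
  ext b
  have hne : ∀ i : Fin n, i ≠ s → (b + Finsupp.single s (t R)) i = b i := fun i hi => by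
    simp [Finsupp.single_eq_of_ne hi]
  refine and_congr ?_ (forall_congr' fun r => forall₂_congr fun hr hrR => ?_)
  · refine forall_congr' fun i => ?_
    rcases eq_or_ne i s with rfl | his
    · simp
    · have : (i : ℕ) ≠ s := fun h => his (Fin.ext h)
      rw [hne i his, mem_insert, or_iff_right his]
      refine imp_congr_left ?_
      omega
  · rw [gapCond_succ_of_pos (hΛ r)]
    · refine gapCond_congr (isLowerSet_linkSet (hΛ r)) fun i hi => ?_
      rw [hne i]
      rintro rfl
      exact lt_irrefl _ hi
    · simpa using le_trans (ht.monotone hrR) (Nat.le_add_left _ _)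

theorem slice_levelSet {s : Fin n} {K : Finset (Fin n)} {R r e : ℕ} {t : ℕ → ℕ}
    {Λ : ℕ → Set (Finset (Fin n))} (hΛ : ∀ r, IsLowerSet (Λ r)) (hmono : Monotone Λ)
    (ht : StrictMono t) (hsK : s ∉ K) (h0 : ∅ ∈ Λ 1) (hrR : r ≤ R) (hre : t r ≤ e)
    (her : e < t (r + 1)) :
    {b | b s = 0 ∧ b + Finsupp.single s e ∈ levelSet (s + 1) K (R + 1) t Λ} =
      levelSet s K R (fun q => if q ≤ r then t q else t (q + 1))
        fun q => if q ≤ r then linkSet s (Λ q) else Λ (q + 1) := by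
  ext b
  have hne : ∀ i : Fin n, i ≠ s → (b + Finsupp.single s e) i = b i := fun i hi => by
    simp [Finsupp.single_eq_of_ne hi]
  have hlt : ∀ i : Fin n, (i : ℕ) < s → (b + Finsupp.single s e) i = b i := fun i hi =>
    hne i (by rintro rfl; exact lt_irrefl _ hi)
  have hzero : (b s = 0 ∧ ∀ i : Fin n, (s : ℕ) + 1 ≤ i → i ∉ K →
      (b + Finsupp.single s e) i = 0) ↔ ∀ i : Fin n, (s : ℕ) ≤ i → i ∉ K → b i = 0 := by
    constructor
    · rintro ⟨h₁, h₂⟩ i hi hiK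
      rcases eq_or_ne i s with rfl | his
      · exact h₁
      · have : (i : ℕ) ≠ s := fun h => his (Fin.ext h)
        rw [← hne i his]
        exact h₂ i (by omega) hiK
    · refine fun h => ⟨h s le_rfl hsK, fun i hi hiK => ?_⟩
      rw [hne i (by rintro rfl; omega)]
      exact h i (by omega) hiK
  change (b s = 0 ∧ _ ∧ _) ↔ (_ ∧ _)
  rw [← and_assoc, hzero]
  refine and_congr_right fun hb => ?_
  have hbs : (b + Finsupp.single s e) s = e := by simp [hb s le_rfl hsK]
  have hle : ∀ q, q ≤ r → (GapCond (s + 1) q (Λ q) (fun i => t q ≤ (b + Finsupp.single s e) i) ↔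
      GapCond s q (linkSet s (Λ q)) fun i => t q ≤ b i) := by
    intro q hq
    rw [gapCond_succ_of_pos (hΛ q) (by rw [hbs]; exact (ht.monotone hq).trans hre)]
    exact gapCond_congr (isLowerSet_linkSet (hΛ q)) fun i hi => by rw [hlt i hi]
  have hgt : ∀ q, r ≤ q →
      (GapCond (s + 1) (q + 1) (Λ (q + 1))
        (fun i => t (q + 1) ≤ (b + Finsupp.single s e) i) ↔
      GapCond s q (Λ (q + 1)) fun i => t (q + 1) ≤ b i) := by
    intro q hq
    rw [gapCond_succ_of_neg (hmono (Nat.le_add_left 1 q) h0)]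
    · exact gapCond_congr (hΛ _) fun i hi => by rw [hlt i hi]
    · rw [hbs, not_le]
      exact her.trans_le (ht.monotone (by omega))
  constructor
  · intro h q hq hqR
    dsimp only
    split_ifs with hqr
    · exact (hle q hqr).1 (h q hq (by omega))
    · exact (hgt q (by omega)).1 (h (q + 1) (by omega) (by omega))
  · intro h q hq hqR
    rcases Nat.lt_trichotomy q (r + 1) with hqr | rfl | hqr
    · have := h q hq (by omega)
      simp only [if_pos (show q ≤ r by omega)] at this
      exact (hle q (by omega)).2 this
    · refine (hgt r le_rfl).2 ?_
      rcases Nat.eq_zero_or_pos r with rfl | hr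
      · intro j _ hj
        exact absurd hj (Nat.not_lt_zero _)
      · have := h r hr hrR
        simp only [if_pos le_rfl] at this
        exact this.mono ((linkSet_subset (hΛ r)).trans (hmono (Nat.le_succ r))) (hΛ _)
          fun i _ hi => (ht.monotone (Nat.le_succ r)).trans hi
    · obtain ⟨p, rfl⟩ : ∃ p, q = p + 1 := ⟨q - 1, by omega⟩
      have := h p (by omega) (by omega)
      simp only [if_neg (show ¬ p ≤ r by omega)] at this
      exact (hgt p (by omega)).2 this

theorem exists_mem_step {t : ℕ → ℕ} (h0 : t 0 = 0) {R e : ℕ} (he : e < t R) :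
    ∃ r < R, t r ≤ e ∧ e < t (r + 1) := by
  induction R with
  | zero => omega
  | succ R ih =>
    by_cases h : e < t R
    · obtain ⟨r, hr, h⟩ := ih h
      exact ⟨r, by omega, h⟩
    · exact ⟨R, by omega, by omega, he⟩

theorem filt_levelSet {d m : ℕ} (hm : m ≤ n) {K : Finset (Fin n)} {R : ℕ} {t : ℕ → ℕ}
    {Λ : ℕ → Set (Finset (Fin n))} (hK : ∀ i ∈ K, m ≤ (i : ℕ)) (hcard : #K + m = d + R)
    (ht : StrictMono t) (ht0 : t 0 = 0) (hΛ : ∀ r, IsLowerSet (Λ r)) (hmono : Monotone Λ)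
    (hbound : ∀ r, ∀ F ∈ Λ r, (∀ i ∈ F, (i : ℕ) < m) → #F + #K ≤ d) :
    Filt d (levelSet m K R t Λ) := by
  induction m generalizing K R t Λ with
  | zero =>
    rcases Nat.eq_zero_or_pos R with rfl | hR
    · convert Filt.face K (by omega : #K = d)
      ext a
      constructor
      · intro h i hi
        by_contra hiK
        exact Finsupp.mem_support_iff.1 hi (h.1 i (Nat.zero_le _) hiK)
      · intro h
        refine ⟨fun i _ hiK => ?_, fun r h₁ h₂ => by omega⟩
        by_contra hi
        exact hiK (h (Finsupp.mem_support_iff.2 hi))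
    · rw [levelSet_eq_empty hR]
      · exact Filt.empty
      · intro h
        have := hbound 1 ∅ h (by simp)
        rw [card_empty] at this
        omega
  | succ m ih =>
    by_cases h0 : 1 ≤ R ∧ ∅ ∉ Λ 1
    · rw [levelSet_eq_empty h0.1 h0.2]
      exact Filt.empty
    obtain ⟨s, rfl⟩ : ∃ s : Fin n, (s : ℕ) = m := ⟨⟨m, hm⟩, rfl⟩
    have hsK : s ∉ K := fun h => by
      have := hK s h
      omega
    refine filt_of_slices s (t R) (isLowerSet_levelSet hΛ) (fun e he => ?_) ?_
    · obtain ⟨r, hrR, hre, her⟩ := exists_mem_step ht0 he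
      obtain ⟨R, rfl⟩ : ∃ R', R = R' + 1 := ⟨R - 1, by omega⟩
      have h0 : ∅ ∈ Λ 1 := by
        by_contra h
        exact h0 ⟨by omega, h⟩
      rw [slice_levelSet hΛ hmono ht hsK h0 (by omega) hre her]
      refine ih (by omega) (fun i hi => ?_) (by omega) (fun p q hpq => ?_) (by simp [ht0])
        (fun q => ?_) (fun p q hpq => ?_) (fun q F hF hFs => ?_)
      · have := hK i hi
        omega
      · split_ifs
        all_goals first
          | omega
          | exact ht (by omega)
      · split_ifs
        · exact isLowerSet_linkSet (hΛ q)
        · exact hΛ _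
      · split_ifs with h₁ h₂
        · exact fun F hF => hmono hpq hF
        · exact (linkSet_subset (hΛ p)).trans (hmono (by omega))
        · omega
        · exact hmono (by omega)
      · split_ifs at hF
        · exact hbound q F (linkSet_subset (hΛ q) hF) fun i hi => (hFs i hi).trans (by omega)
        · exact hbound _ F hF fun i hi => (hFs i hi).trans (by omega)
    · rw [shift_levelSet_top hΛ ht hsK hK]
      refine ih (by omega) (fun i hi => ?_) ?_ ht ht0 (fun r => isLowerSet_linkSet (hΛ r))
        (fun p q hpq F hF => hmono hpq hF) (fun q F hF hFs => ?_)
      · rcases mem_insert.1 hi with rfl | hi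
        · exact le_rfl
        · have := hK i hi
          omega
      · rw [card_insert_of_notMem hsK]
        omega
      · have hsF : s ∉ F := fun h => lt_irrefl _ (hFs s h)
        have := hbound q _ hF fun i hi => by
          rcases mem_insert.1 hi with rfl | hi
          · omega
          · exact (hFs i hi).trans (by omega)
        rw [card_insert_of_notMem hsF] at this
        rw [card_insert_of_notMem hsK]
        omega

end LevelSets

section Shifted

variable {n : ℕ} {Γ : Finset (Finset (Fin n))}

theorem IsMinNonFace.eq_of_subset (hdown : ∀ σ ∈ Γ, ∀ τ ⊆ σ, τ ∈ Γ) {σ τ : Finset (Fin n)}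
    (hσ : σ ∉ Γ) (hτ : IsMinNonFace Γ τ) (h : σ ⊆ τ) : σ = τ := by
  refine h.antisymm fun i hi => ?_
  by_contra hiσ
  exact hσ (hdown _ (hτ.2 i hi) σ (subset_erase.2 ⟨h, hiσ⟩))

theorem exists_isMinNonFace_filter (hdown : ∀ σ ∈ Γ, ∀ τ ⊆ σ, τ ∈ Γ) (hsh : IsShifted Γ)
    (h0 : ∅ ∈ Γ) {U : Finset (Fin n)} (hU : U ∉ Γ) :
    ∃ x ∈ U, IsMinNonFace Γ {i ∈ U | x ≤ i} := by
  have hne : ({x ∈ U | {i ∈ U | x ≤ i} ∉ Γ} : Finset (Fin n)).Nonempty := by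
    have hUne : U.Nonempty := by
      rw [nonempty_iff_ne_empty]
      rintro rfl
      exact hU h0
    refine ⟨U.min' hUne, mem_filter.2 ⟨U.min'_mem hUne, ?_⟩⟩
    rwa [filter_true_of_mem fun i hi => U.min'_le i hi]
  obtain ⟨x, hx, hmax⟩ := exists_max_image _ id hne
  obtain ⟨hxU, hx⟩ := mem_filter.1 hx
  have hgt : ({i ∈ U | x < i} : Finset (Fin n)) ∈ Γ := by
    by_contra hnot
    have hne : ({i ∈ U | x < i} : Finset (Fin n)).Nonempty := by
      rw [nonempty_iff_ne_empty]
      intro h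
      exact hnot (h ▸ h0)
    set y := ({i ∈ U | x < i} : Finset (Fin n)).min' hne with hy
    obtain ⟨hyU, hxy⟩ := mem_filter.1 (min'_mem _ hne)
    refine absurd (hmax y (mem_filter.2 ⟨hyU, fun h => hnot (hdown _ h _ fun i hi => ?_)⟩))
      (not_le.2 hxy)
    exact mem_filter.2 ⟨(mem_filter.1 hi).1, min'_le _ i hi⟩
  refine ⟨x, hxU, hx, fun y hy => ?_⟩
  obtain ⟨hyU, hxy⟩ := mem_filter.1 hy
  rcases hxy.eq_or_lt with rfl | hxy
  · convert hgt using 1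
    ext i
    simp only [mem_erase, mem_filter, lt_iff_le_and_ne, ne_comm (a := x)]
    tauto
  · convert hsh _ hgt y (mem_filter.2 ⟨hyU, hxy⟩) x hxy using 1
    ext i
    simp only [mem_erase, mem_filter, mem_insert, le_iff_lt_or_eq]
    constructor
    · rintro ⟨h₁, h₂, h₃ | rfl⟩
      · exact Or.inr ⟨h₁, h₂, h₃⟩
      · exact Or.inl rfl
    · rintro (rfl | ⟨h₁, h₂, h₃⟩)
      · exact ⟨hxy.ne, hxU, Or.inr rfl⟩
      · exact ⟨h₁, h₂, Or.inl h₃⟩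

theorem minVal_eq {σ : Finset (Fin n)} {v : Fin n} (hv : v ∈ σ) (hmin : ∀ w ∈ σ, v ≤ w) :
    minVal σ = v := by
  refine IsLeast.csInf_eq ⟨⟨v, hv, rfl⟩, ?_⟩
  rintro _ ⟨w, hw, rfl⟩
  exact hmin w hw

theorem val_add_card_le {σ : Finset (Fin n)} {v : Fin n} (hmin : ∀ w ∈ σ, v ≤ w) :
    (v : ℕ) + #σ ≤ n := by
  have : #σ ≤ #(Finset.Ici v) := card_le_card fun w hw => Finset.mem_Ici.2 (hmin w hw)
  rw [Fin.card_Ici] at this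
  omega

theorem exists_min_of_notMem (h0 : ∅ ∈ Γ) {σ : Finset (Fin n)} (hσ : σ ∉ Γ) :
    ∃ v ∈ σ, ∀ w ∈ σ, v ≤ w := by
  have hne : σ.Nonempty := by
    rw [nonempty_iff_ne_empty]
    rintro rfl
    exact hσ h0
  exact ⟨σ.min' hne, σ.min'_mem hne, fun w hw => σ.min'_le w hw⟩

theorem shiftExp_of_mem {σ : Finset (Fin n)} {v i : Fin n} (hv : v ∈ σ)
    (hmin : ∀ w ∈ σ, v ≤ w) (hi : i ∈ σ) : shiftExp n σ i = n + 1 - #σ - v := by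
  rw [shiftExp, if_pos hi, minVal_eq hv hmin]

theorem shiftExp_pos_iff (h0 : ∅ ∈ Γ) {σ : Finset (Fin n)} (hσ : σ ∉ Γ) (i : Fin n) :
    0 < shiftExp n σ i ↔ i ∈ σ := by
  obtain ⟨v, hv, hmin⟩ := exists_min_of_notMem h0 hσ
  have := val_add_card_le hmin
  by_cases hi : i ∈ σ
  · rw [shiftExp_of_mem hv hmin hi]
    simp only [hi, iff_true]
    omega
  · simp [shiftExp, hi]

theorem lt_val_add_card_of_isMinNonFace (hdown : ∀ σ ∈ Γ, ∀ τ ⊆ σ, τ ∈ Γ) (hsh : IsShifted Γ)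
    {d : ℕ} (hp : IsPureDim Γ d) {σ : Finset (Fin n)} (hσ : IsMinNonFace Γ σ) {v : Fin n}
    (hv : v ∈ σ) : d < v + #σ := by
  by_contra! hle
  obtain ⟨G, hG, hGmax⟩ := exists_max_image ({τ ∈ Γ | σ.erase v ⊆ τ} : Finset _) card
    ⟨_, mem_filter.2 ⟨hσ.2 v hv, Subset.rfl⟩⟩
  obtain ⟨hGΓ, hBG⟩ := mem_filter.1 hG
  have hGcard : #G = d := hp.2 G ⟨hGΓ, fun τ hτ hGτ =>
    (eq_of_subset_of_card_le hGτ (hGmax τ (mem_filter.2 ⟨hτ, hBG.trans hGτ⟩))).symm⟩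
  have hvG : v ∉ G := fun h => hσ.1 (hdown G hGΓ σ (by
    rw [← insert_erase hv]
    exact insert_subset h hBG))
  have hlt : #(Finset.Iio v) < #(G \ σ.erase v) := by
    rw [card_sdiff_of_subset hBG, card_erase_of_mem hv, Fin.card_Iio]
    have := card_pos.2 ⟨v, hv⟩
    omega
  obtain ⟨u, hu, hvu⟩ := exists_mem_notMem_of_card_lt_card hlt
  obtain ⟨huG, huB⟩ := mem_sdiff.1 hu
  have hvu : v < u := lt_of_le_of_ne (not_lt.1 fun h => hvu (Finset.mem_Iio.2 h))
    (by rintro rfl; exact hvG huG)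
  refine hσ.1 (hdown _ (hsh G hGΓ u huG v hvu) σ ?_)
  rw [← insert_erase hv]
  exact insert_subset_insert v (subset_erase.2 ⟨hBG, huB⟩)

theorem val_add_card_lt_of_ne (hdown : ∀ σ ∈ Γ, ∀ τ ⊆ σ, τ ∈ Γ) {σ U : Finset (Fin n)} {v x : Fin n}
    (hσ : IsMinNonFace Γ σ) (hmin : ∀ w ∈ σ, v ≤ w) (hσU : σ ⊆ U)
    (hρ : IsMinNonFace Γ {i ∈ U | x ≤ i}) (hne : {i ∈ U | x ≤ i} ≠ σ) :
    (v : ℕ) + #σ < x + #{i ∈ U | x ≤ i} := by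
  have hvx : v ≤ x := by
    by_contra! hxv
    exact hne (hρ.eq_of_subset hdown hσ.1 fun i hi =>
      mem_filter.2 ⟨hσU hi, hxv.le.trans (hmin i hi)⟩).symm
  have hsub : {i ∈ σ | x ≤ i} ⊂ {i ∈ U | x ≤ i} := by
    refine ssubset_of_subset_of_ne (filter_subset_filter _ hσU) fun h => hne ?_
    exact hσ.eq_of_subset hdown hρ.1 (h ▸ filter_subset _ _)
  have h₁ := card_lt_card hsub
  have h₂ : #{i ∈ σ | ¬ x ≤ i} ≤ #(Finset.Ico v x) := card_le_card fun i hi =>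
    Finset.mem_Ico.2 ⟨hmin i (mem_filter.1 hi).1, not_le.1 (mem_filter.1 hi).2⟩
  rw [Fin.card_Ico] at h₂
  have h₃ := card_filter_add_card_filter_not (s := σ) (fun i => x ≤ i)
  have : (v : ℕ) ≤ x := hvx
  omega

theorem isGeneric_image_shiftExp (hdown : ∀ σ ∈ Γ, ∀ τ ⊆ σ, τ ∈ Γ) (hsh : IsShifted Γ)
    (h0 : ∅ ∈ Γ) : IsGeneric ((minNonFaces Γ).image (shiftExp n)) := by
  have hmem : ∀ σ, σ ∈ minNonFaces Γ ↔ IsMinNonFace Γ σ := fun σ => by simp [minNonFaces]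
  refine ⟨?_, ?_⟩
  · intro a ha b hb hab
    obtain ⟨σ, hσ, rfl⟩ := mem_image.1 ha
    obtain ⟨τ, hτ, rfl⟩ := mem_image.1 hb
    rw [hmem] at hσ hτ
    rw [hτ.eq_of_subset hdown hσ.1 fun i hi => ?_]
    exact (shiftExp_pos_iff h0 hτ.1 i).1 (((shiftExp_pos_iff h0 hσ.1 i).2 hi).trans_le (hab i))
  · rintro a ha b hb hab ⟨h, heq, hpos⟩
    obtain ⟨σ, hσ, rfl⟩ := mem_image.1 ha
    obtain ⟨τ, hτ, rfl⟩ := mem_image.1 hb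
    rw [hmem] at hσ hτ
    have hστ : σ ≠ τ := by
      rintro rfl
      exact hab rfl
    have hhσ := (shiftExp_pos_iff h0 hσ.1 h).1 hpos
    have hhτ := (shiftExp_pos_iff h0 hτ.1 h).1 (heq ▸ hpos)
    obtain ⟨v, hv, hvmin⟩ := exists_min_of_notMem h0 hσ.1
    obtain ⟨w, hw, hwmin⟩ := exists_min_of_notMem h0 hτ.1
    have hvn := val_add_card_le hvmin
    have hwn := val_add_card_le hwmin
    rw [shiftExp_of_mem hv hvmin hhσ, shiftExp_of_mem hw hwmin hhτ] at heq
    obtain ⟨x, hxU, hρ⟩ := exists_isMinNonFace_filter hdown hsh h0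
      (U := σ ∪ τ) fun h => hσ.1 (hdown _ h σ subset_union_left)
    set ρ : Finset (Fin n) := {i ∈ σ ∪ τ | x ≤ i} with hρdef
    have hxρ : x ∈ ρ := mem_filter.2 ⟨hxU, le_rfl⟩
    have hxmin : ∀ w ∈ ρ, x ≤ w := fun w hw => (mem_filter.1 hw).2
    have hlt : (v : ℕ) + #σ < x + #ρ := by
      by_cases hρσ : ρ = σ
      · have : (w : ℕ) + #τ < x + #ρ := val_add_card_lt_of_ne hdown hτ hwmin subset_union_right hρ
          (fun h => hστ (hρσ.symm.trans h))
        omega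
      · exact val_add_card_lt_of_ne hdown hσ hvmin subset_union_left hρ hρσ
    have hstrict : StrictlyDivides (shiftExp n ρ)
        fun i => max (shiftExp n σ i) (shiftExp n τ i) := by
      intro i hi
      have hiρ := (shiftExp_pos_iff h0 hρ.1 i).1 hi
      rw [shiftExp_of_mem hxρ hxmin hiρ]
      rcases mem_union.1 (mem_filter.1 hiρ).1 with h | h
      · refine lt_max_of_lt_left ?_
        rw [shiftExp_of_mem hv hvmin h]
        omega
      · refine lt_max_of_lt_right ?_
        rw [shiftExp_of_mem hw hwmin h]
        omega
    have hne : ∀ ψ, IsMinNonFace Γ ψ → (∀ y ∈ ψ, (∀ z ∈ ψ, y ≤ z) → (y : ℕ) + #ψ ≠ x + #ρ) →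
        shiftExp n ρ ≠ shiftExp n ψ := by
      intro ψ hψ hcard h
      have : ρ = ψ := by
        ext i
        rw [← shiftExp_pos_iff h0 hρ.1, ← shiftExp_pos_iff h0 hψ.1, h]
      subst this
      exact hcard x hxρ hxmin rfl
    refine ⟨shiftExp n ρ, mem_image_of_mem _ ((hmem ρ).2 hρ), hne σ hσ ?_, hne τ hτ ?_, hstrict⟩
    · intro y hy hymin
      rw [le_antisymm (hymin v hv) (hvmin y hy)]
      omega
    · intro y hy hymin
      rw [le_antisymm (hymin w hw) (hwmin y hy)]
      omega

theorem monIdeal_eq_complIdeal (k : Type*) [Field k] (G : Finset (Fin n → ℕ)) :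
    monIdeal k G = complIdeal k {a | ∀ g ∈ G, ¬ g ≤ a} := by
  apply le_antisymm
  · refine Ideal.span_le.2 ?_
    rintro _ ⟨g, hg, rfl⟩
    have : Finsupp.equivFunOnFinite.symm g ∉ {a : Fin n →₀ ℕ | ∀ g ∈ G, ¬ g ≤ a} :=
      fun h => h g hg fun i => by simp
    exact monomial_mem_complIdeal this 1
  · refine Ideal.span_le.2 ?_
    rintro _ ⟨a, ha, rfl⟩
    obtain ⟨g, hg, hga⟩ : ∃ g ∈ G, g ≤ a := by
      by_contra! h
      exact ha h
    have : MvPolynomial.monomial a (1 : k) =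
        MvPolynomial.monomial (a - Finsupp.equivFunOnFinite.symm g) 1 * mono k g := by
      rw [mono, MvPolynomial.monomial_mul, tsub_add_cancel_of_le, one_mul]
      exact fun i => hga i
    change MvPolynomial.monomial a (1 : k) ∈ monIdeal k G
    rw [this]
    exact Ideal.mul_mem_left _ _ (Ideal.subset_span ⟨g, hg, rfl⟩)

theorem avoid_shiftExp_eq_levelSet (hdown : ∀ σ ∈ Γ, ∀ τ ⊆ σ, τ ∈ Γ) (hsh : IsShifted Γ)
    (h0 : ∅ ∈ Γ) {d : ℕ} (hp : IsPureDim Γ d) :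
    {a : Fin n →₀ ℕ | ∀ g ∈ (minNonFaces Γ).image (shiftExp n), ¬ g ≤ a} =
      levelSet n ∅ (n - d) id fun _ => (Γ : Set (Finset (Fin n))) := by
  ext a
  constructor
  · intro ha
    refine ⟨fun i hi => absurd i.2 (by omega), fun t _ _ j _ hlt => ?_⟩
    by_contra hnot
    obtain ⟨U, hmemU, hnot⟩ : ∃ U : Finset (Fin n),
        (∀ i, i ∈ U ↔ j ≤ (i : ℕ) ∧ t ≤ a i) ∧ U ∉ Γ := ⟨_, fun i => by simp, hnot⟩
    obtain ⟨V, hmemV, hlt⟩ : ∃ V : Finset (Fin n),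
        (∀ i, i ∈ V ↔ j ≤ (i : ℕ) ∧ ¬ t ≤ a i) ∧ #V < t := ⟨_, fun i => by simp, hlt⟩
    obtain ⟨x, hx, hρ⟩ := exists_isMinNonFace_filter hdown hsh h0 hnot
    have hxmin : ∀ w ∈ ({i ∈ U | x ≤ i} : Finset (Fin n)), x ≤ w := fun w hw =>
      (mem_filter.1 hw).2
    have hxρ : x ∈ ({i ∈ U | x ≤ i} : Finset (Fin n)) := mem_filter.2 ⟨hx, le_rfl⟩
    have hjx : j ≤ (x : ℕ) := ((hmemU x).1 hx).1
    refine ha _ (mem_image_of_mem _ (by simpa [minNonFaces] using hρ)) fun i => ?_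
    by_cases hi : i ∈ ({i ∈ U | x ≤ i} : Finset (Fin n))
    · rw [shiftExp_of_mem hxρ hxmin hi]
      refine le_trans ?_ ((hmemU i).1 (mem_filter.1 hi).1).2
      have hsub : Finset.Ici x ⊆ ({i ∈ U | x ≤ i} : Finset (Fin n)) ∪ V := by
        intro y hy
        have hxy : x ≤ y := Finset.mem_Ici.1 hy
        have hjy : j ≤ (y : ℕ) := hjx.trans hxy
        simp only [mem_union, mem_filter, hmemU, hmemV, hxy, hjy, true_and, and_true]
        exact em _
      have h₁ := (card_le_card hsub).trans (card_union_le _ _)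
      rw [Fin.card_Ici] at h₁
      change _ ≤ t
      omega
    · rw [shiftExp, if_neg hi]
      exact Nat.zero_le _
  · rintro ⟨-, ha⟩ g hg hga
    obtain ⟨σ, hσ, rfl⟩ := mem_image.1 hg
    replace hσ : IsMinNonFace Γ σ := by simpa [minNonFaces] using hσ
    obtain ⟨v, hv, hvmin⟩ := exists_min_of_notMem h0 hσ.1
    have hvn := val_add_card_le hvmin
    have hvd := lt_val_add_card_of_isMinNonFace hdown hsh hp hσ hv
    have hle : ∀ i ∈ σ, n + 1 - #σ - v ≤ a i := fun i hi => by
      rw [← shiftExp_of_mem hv hvmin hi]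
      exact hga i
    refine hσ.1 (hdown _ (ha (n + 1 - #σ - v) (by omega) (by omega) v v.2.le ?_) σ ?_)
    · refine lt_of_le_of_lt (card_le_card (t := Finset.Ici v \ σ) fun i hi => ?_) ?_
      · simp only [mem_filter, mem_univ, true_and] at hi
        exact mem_sdiff.2 ⟨Finset.mem_Ici.2 hi.1, fun h => hi.2.2 (hle i h)⟩
      · rw [card_sdiff_of_subset fun w hw => Finset.mem_Ici.2 (hvmin w hw), Fin.card_Ici]
        omega
    · intro i hi
      simp only [mem_filter, mem_univ, true_and]
      exact ⟨hvmin i hi, i.2, hle i hi⟩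

theorem isCMQuotient_monIdeal_shiftExp (k : Type*) [Field k] (hdown : ∀ σ ∈ Γ, ∀ τ ⊆ σ, τ ∈ Γ)
    (hsh : IsShifted Γ) {d : ℕ} (hp : IsPureDim Γ d) :
    IsCMQuotient k (monIdeal k ((minNonFaces Γ).image (shiftExp n))) := by
  obtain ⟨F, hF, hFd⟩ := hp.1.2
  have h0 : ∅ ∈ Γ := hdown F hF ∅ (empty_subset F)
  have hdn : d ≤ n := hFd ▸ card_finset_fin_le F
  have hfilt : Filt d (levelSet n ∅ (n - d) id fun _ => (Γ : Set (Finset (Fin n)))) := by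
    refine filt_levelSet le_rfl (by simp) (by simp; omega) strictMono_id rfl
      (fun _ σ τ hτσ hσ => hdown σ hσ τ hτσ) (fun _ _ _ => subset_rfl) fun _ σ hσ _ => ?_
    simpa using hp.1.1 σ hσ
  rw [← avoid_shiftExp_eq_levelSet hdown hsh h0 hp] at hfilt
  rw [monIdeal_eq_complIdeal]
  refine hfilt.isCMQuotient hFd fun a ha g hg hga => ?_
  obtain ⟨σ, hσ, rfl⟩ := mem_image.1 hg
  replace hσ : IsMinNonFace Γ σ := by simpa [minNonFaces] using hσ
  refine hσ.1 (hdown F hF σ fun i hi => ha (Finsupp.mem_support_iff.2 ?_))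
  exact (((shiftExp_pos_iff h0 hσ.1 i).2 hi).trans_le (hga i)).ne'

end Shifted

/-- For a shellable (equivalently pure) shifted complex `Γ`
of dimension `d-1` on `[n]`, the explicit ideal `M = M_1 + ⋯ + M_{n-d}`, where
`M_j` is generated by `∏_{i ∈ σ} x_i^{n-d-j+1}` over `σ ∈ Σ_j`, is a generic
Cohen-Macaulay deformation of `I_Γ`. -/
theorem shifted_generic_CM_deformation (k : Type*) [Field k] {n d : ℕ}
    (Γ : Finset (Finset (Fin n))) (hc : IsComplexOn Finset.univ Γ)
    (hsh : IsShifted Γ) (hp : IsPureDim Γ d) :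
    (∀ j, 1 ≤ j → j ≤ n - d → ∀ σ, MemSigma Γ d j σ →
      ∀ i ∈ σ, shiftExp n σ i = n - d - j + 1) ∧
    (∀ σ ∈ minNonFaces Γ, ∀ i : Fin n, 0 < shiftExp n σ i ↔ i ∈ σ) ∧
    IsGeneric ((minNonFaces Γ).image (shiftExp n)) ∧
    IsCMQuotient k (monIdeal k ((minNonFaces Γ).image (shiftExp n))) := by
  obtain ⟨-, -, hdown⟩ := hc
  obtain ⟨F, hF, -⟩ := hp.1.2
  have h0 : ∅ ∈ Γ := hdown F hF ∅ (empty_subset F)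
  refine ⟨?_, fun σ hσ i => shiftExp_pos_iff h0 (mem_filter.1 hσ).2.1 i,
    isGeneric_image_shiftExp hdown hsh h0, isCMQuotient_monIdeal_shiftExp k hdown hsh hp⟩
  rintro j hj hjn σ ⟨-, v, hv, hmin, hcard⟩ i hi
  rw [shiftExp_of_mem hv hmin hi]
  omega
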